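/- arXiv:math/9406212 — 2 statements merged into one kernel-verified Lean document; each statement's English description precedes it below -/
import Mathlib

section
/- Let $(\Omega,\Sigma,\mu)$ be a probability space, $N \ge 1$, $P = \mu^{\otimes N}$, and $\alpha > 0$. For $A \subseteq \Omega^N$ and $x \in \Omega^N$, let $V_A(x) \subseteq \mathbb{R}^N$ be the convex hull of $U_A(x) = \{s \in \{0,1\}^N : \exists y \in A,\ s_i = 0 \Rightarrow x_i = y_i\}$, and set $f_\alpha(A,x) = \inf\{\sum_{i \le N} \xi(\alpha, s_i) : s \in V_A(x)\}$, where $\xi(\alpha,u) = \alpha(1-u)\log(1-u) - (\alpha+1-\alpha u)\log\big((1+\alpha-\alpha u)/(1+\alpha)\big)$. Then for every measurable $A$ with $P(A) > 0$: $\int^* \exp f_\alpha(A,x)\, dP(x) \le \frac{1}{P(A)^{\alpha}}$. -/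
open MeasureTheory ENNReal

/-- The upper (outer) integral: infimum of `∫⁻ g` over measurable `g ≥ f`. -/
noncomputable def upperLintegral {α : Type*} [MeasurableSpace α] (μ : Measure α)
    (f : α → ℝ≥0∞) : ℝ≥0∞ :=
  ⨅ (g : α → ℝ≥0∞) (_ : Measurable g) (_ : ∀ x, f x ≤ g x), ∫⁻ x, g x ∂μ

/-- The product probability `μ^{⊗N}` on `Ω^N`. -/
noncomputable def piP {Ω : Type*} [MeasurableSpace Ω] (μ : Measure Ω) [SigmaFinite μ]
    (N : ℕ) : Measure (Fin N → Ω) :=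
  Measure.pi fun _ : Fin N => μ

/-- `U_A(x) = {s ∈ {0,1}^N : ∃ y ∈ A, s_i = 0 → x_i = y_i} ⊆ ℝ^N`. -/
def convUA {N : ℕ} {Ω : Type*} (A : Set (Fin N → Ω)) (x : Fin N → Ω) :
    Set (Fin N → ℝ) :=
  {s | (∀ i, s i = 0 ∨ s i = 1) ∧ ∃ y ∈ A, ∀ i, s i = 0 → x i = y i}

/-- `ξ(α,u) = α(1-u)log(1-u) - (α+1-αu) log((1+α-αu)/(1+α))` (`0 log 0 = 0` is
automatic since `Real.log 0 = 0`). -/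
noncomputable def xiTal (α u : ℝ) : ℝ :=
  α * (1 - u) * Real.log (1 - u) -
    (α + 1 - α * u) * Real.log ((1 + α - α * u) / (1 + α))

/-- `f_α(A,x) = inf { ∑_{i ≤ N} ξ(α, s_i) : s ∈ V_A(x) }`, where `V_A(x)` is the
convex hull of `U_A(x)`. -/
noncomputable def fAlpha {N : ℕ} {Ω : Type*} (α : ℝ) (A : Set (Fin N → Ω))
    (x : Fin N → Ω) : ℝ :=
  ⨅ s : convexHull ℝ (convUA A x), ∑ i, xiTal α ((s : Fin N → ℝ) i)

open Set Filter Topology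

section xi

variable {α : ℝ}

lemma continuousOn_xiTal (hα : 0 < α) : ContinuousOn (xiTal α) (Icc 0 1) := by
  have h1 : Continuous fun u : ℝ => α * ((1 - u) * Real.log (1 - u)) :=
    continuous_const.mul (Real.continuous_mul_log.comp (continuous_const.sub continuous_id))
  have h2 : ContinuousOn (fun u : ℝ =>
      (α + 1 - α * u) * Real.log ((1 + α - α * u) / (1 + α))) (Icc 0 1) := by
    refine ContinuousOn.mul (by fun_prop) (ContinuousOn.log (by fun_prop) ?_)
    intro u hu
    have : 0 < 1 + α - α * u := by nlinarith [hu.2]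
    positivity
  refine (h1.continuousOn.sub h2).congr fun u _ => ?_
  simp only [xiTal, mul_assoc, Pi.sub_apply]

lemma hasDerivAt_xiTal (hα : 0 < α) {u : ℝ} (hu : u < 1) :
    HasDerivAt (xiTal α)
      (α * (Real.log (1 + α - α * u) - Real.log (1 + α) - Real.log (1 - u))) u := by
  have hv : 1 - u ≠ 0 := by linarith
  have hw : 1 + α - α * u ≠ 0 := by nlinarith
  have hα' : 1 + α ≠ 0 := by positivity
  have d1 : HasDerivAt (fun u : ℝ => 1 - u) (-1) u := by
    simpa using (hasDerivAt_id u).const_sub 1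
  have d2 : HasDerivAt (fun u : ℝ => 1 + α - α * u) (-α) u := by
    simpa using ((hasDerivAt_id u).const_mul α).const_sub (1 + α)
  have d3 : HasDerivAt (fun u : ℝ => α + 1 - α * u) (-α) u := by
    simpa using ((hasDerivAt_id u).const_mul α).const_sub (α + 1)
  have h := ((d1.const_mul α).mul (d1.log hv)).sub
    (d3.mul ((d2.div_const (1 + α)).log (div_ne_zero hw hα')))
  refine h.congr_deriv ?_
  rw [Real.log_div hw hα']
  have : α + 1 - α * u = 1 + α - α * u := by ring
  rw [this]
  field_simp
  ring

lemma convexOn_xiTal (hα : 0 < α) : ConvexOn ℝ (Icc 0 1) (xiTal α) := by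
  refine MonotoneOn.convexOn_of_deriv (convex_Icc 0 1) (continuousOn_xiTal hα) ?_ ?_
  · rw [interior_Icc]
    exact fun u hu => (hasDerivAt_xiTal hα hu.2).differentiableAt.differentiableWithinAt
  · rw [interior_Icc]
    intro u hu w hw huw
    rw [(hasDerivAt_xiTal hα hu.2).deriv, (hasDerivAt_xiTal hα hw.2).deriv]
    have h1 : 0 < 1 - u := by linarith [hu.2]
    have h2 : 0 < 1 - w := by linarith [hw.2]
    have h3 : 0 < 1 + α - α * u := by nlinarith
    have h4 : 0 < 1 + α - α * w := by nlinarith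
    have key : Real.log ((1 + α - α * u) * (1 - w)) ≤ Real.log ((1 + α - α * w) * (1 - u)) :=
      Real.log_le_log (by positivity) (by nlinarith)
    rw [Real.log_mul h3.ne' h2.ne', Real.log_mul h4.ne' h1.ne'] at key
    exact mul_le_mul_of_nonneg_left (by linarith) hα.le

lemma xiTal_nonneg (hα : 0 < α) {u : ℝ} (hu : u ∈ Icc (0 : ℝ) 1) : 0 ≤ xiTal α u := by
  have hp : 0 < 1 + α - α * u := by nlinarith [hu.2]
  rcases hu.2.eq_or_lt with rfl | h1
  · have h : Real.log ((1 + α - α * 1) / (1 + α)) ≤ 0 :=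
      Real.log_nonpos (by positivity) ((div_le_one (by positivity)).2 (by linarith))
    simp only [xiTal, sub_self, mul_zero, zero_mul]
    nlinarith
  · have hv : 0 < 1 - u := by linarith
    have e : xiTal α u = α * (1 - u) * (- Real.log ((1 + α - α * u) / ((1 - u) * (1 + α))))
        + (- Real.log ((1 + α - α * u) / (1 + α))) := by
      rw [xiTal, Real.log_div hp.ne' (by positivity), Real.log_div hp.ne' (by positivity),
        Real.log_mul hv.ne' (by positivity)]
      ring
    have l1 := Real.log_le_sub_one_of_pos
      (show 0 < (1 + α - α * u) / ((1 - u) * (1 + α)) by positivity)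
    have l2 := Real.log_le_sub_one_of_pos (show 0 < (1 + α - α * u) / (1 + α) by positivity)
    have e2 : α * (1 - u) * ((1 + α - α * u) / ((1 - u) * (1 + α)) - 1)
        + ((1 + α - α * u) / (1 + α) - 1) = 0 := by
      field_simp
      ring
    have := mul_le_mul_of_nonneg_left l1 (show 0 ≤ α * (1 - u) by positivity)
    rw [e]
    linarith

/-- The weight `l = r / (1 + α - α r)` optimizes the exponent in the induction. -/
lemma xiTal_one_sub_optimal (hα : 0 < α) {r : ℝ} (hr : 0 < r) (hr1 : r ≤ 1) :
    xiTal α (1 - r / (1 + α - α * r)) - α * (r / (1 + α - α * r)) * Real.log r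
      = Real.log (1 + α - α * r) := by
  have hD : 0 < 1 + α - α * r := by nlinarith
  have e1 : (1 + α - α * (1 - r / (1 + α - α * r))) / (1 + α) = 1 / (1 + α - α * r) := by
    field_simp
    ring
  have e2 : α + 1 - α * (1 - r / (1 + α - α * r)) = 1 + α * (r / (1 + α - α * r)) := by ring
  rw [xiTal, e1, e2, _root_.sub_sub_cancel, Real.log_div hr.ne' hD.ne', one_div, Real.log_inv]
  ring

lemma exists_weight_le (hα : 0 < α) {p M : ℝ≥0∞} (hpM : p ≤ M) (hM0 : M ≠ 0) (hM : M ≠ ∞) :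
    ∃ l ∈ Icc (0 : ℝ) 1,
      ENNReal.ofReal (Real.exp (xiTal α (1 - l))) * (p ^ (-α)) ^ l * (M ^ (-α)) ^ (1 - l)
        ≤ M ^ (-α) * ENNReal.ofReal (1 + α - α * (p / M).toReal) := by
  have hp : p ≠ ∞ := ne_top_of_le_ne_top hM hpM
  rcases eq_or_ne p 0 with rfl | hp0
  · refine ⟨0, by simp, ?_⟩
    have : xiTal α (1 - 0) = Real.log (1 + α) := by
      simp [xiTal, Real.log_inv]
    rw [this, Real.exp_log (by positivity)]
    simp [mul_comm]
  obtain ⟨a, ha, rfl⟩ : ∃ a : ℝ, 0 < a ∧ ENNReal.ofReal a = p :=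
    ⟨p.toReal, ENNReal.toReal_pos hp0 hp, ENNReal.ofReal_toReal hp⟩
  obtain ⟨b, hb, rfl⟩ : ∃ b : ℝ, 0 < b ∧ ENNReal.ofReal b = M :=
    ⟨M.toReal, ENNReal.toReal_pos hM0 hM, ENNReal.ofReal_toReal hM⟩
  have hab : a ≤ b := (ENNReal.ofReal_le_ofReal_iff hb.le).1 hpM
  have hr : 0 < a / b := by positivity
  have hr1 : a / b ≤ 1 := (div_le_one hb).2 hab
  have hD : 0 < 1 + α - α * (a / b) := by nlinarith
  have h := xiTal_one_sub_optimal hα hr hr1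
  set l := a / b / (1 + α - α * (a / b)) with hl
  refine ⟨l, ⟨by positivity, (div_le_one hD).2 (by nlinarith)⟩, ?_⟩
  rw [← ENNReal.ofReal_div_of_pos hb, ENNReal.toReal_ofReal hr.le,
    ENNReal.ofReal_rpow_of_pos ha, ENNReal.ofReal_rpow_of_pos hb,
    ENNReal.ofReal_rpow_of_pos (by positivity), ENNReal.ofReal_rpow_of_pos (by positivity),
    ← ENNReal.ofReal_mul (by positivity), ← ENNReal.ofReal_mul (by positivity),
    ← ENNReal.ofReal_mul (by positivity)]
  refine ENNReal.ofReal_le_ofReal (le_of_eq ?_)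
  rw [← Real.rpow_mul ha.le, ← Real.rpow_mul hb.le, Real.rpow_def_of_pos ha,
    Real.rpow_def_of_pos hb, Real.rpow_def_of_pos hb, ← Real.exp_add, ← Real.exp_add]
  have e := Real.exp_log hD
  generalize 1 + α - α * (a / b) = D at e h ⊢
  rw [← e, ← Real.exp_add, ← h, Real.log_div ha.ne' hb.ne']
  ring_nf

lemma one_add_sub_le_rpow_neg {q : ℝ} (hα : 0 < α) (hq : 0 < q) :
    1 + α - α * q ≤ q ^ (-α) := by
  rw [Real.rpow_def_of_pos hq]
  have h1 := Real.add_one_le_exp (Real.log q * -α)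
  have h2 := mul_le_mul_of_nonneg_left (Real.log_le_sub_one_of_pos hq) hα.le
  linarith

end xi

section mixed

variable {Ω : Type*} {N : ℕ}

/-- The sets of coordinates of `x` that can be replaced by elements of `C` so as to land in `A`. -/
def replSet (C : Set Ω) (A : Set (Fin N → Ω)) (x : Fin N → Ω) : Set (Fin N → Bool) :=
  {b | ∃ c : Fin N → Ω, (∀ i, c i ∈ C) ∧ (fun i => if b i then c i else x i) ∈ A}

/-- The `0`-`1` vector of a Boolean vector. -/
def boolVec (b : Fin N → Bool) : Fin N → ℝ := fun i => if b i then 1 else 0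

/-- The infimum of `exp (∑ ξ(α, s_i))` over the convex hull of a family of `0`-`1` vectors. -/
noncomputable def expInf (α : ℝ) (S : Set (Fin N → Bool)) : ℝ≥0∞ :=
  ⨅ s : convexHull ℝ (boolVec '' S), ENNReal.ofReal (Real.exp (∑ i, xiTal α (s.1 i)))

/-- The analogue of `exp f_α(A, x)` in which coordinates are only replaced by elements of `C`. -/
noncomputable def expF (α : ℝ) (C : Set Ω) (A : Set (Fin N → Ω)) (x : Fin N → Ω) : ℝ≥0∞ :=
  expInf α (replSet C A x)

lemma boolVec_mem_convUA {C : Set Ω} {A : Set (Fin N → Ω)} {x : Fin N → Ω} {b : Fin N → Bool}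
    (hb : b ∈ replSet C A x) : boolVec b ∈ convUA A x := by
  obtain ⟨c, -, hc⟩ := hb
  refine ⟨fun i => ?_, _, hc, fun i hi => ?_⟩
  · by_cases h : b i <;> simp [boolVec, h]
  · by_cases h : b i
    · simp [boolVec, h] at hi
    · simp [h]

lemma mem_Icc_of_mem_convexHull {U : Set (Fin N → ℝ)} (hU : ∀ s ∈ U, ∀ i, s i = 0 ∨ s i = 1)
    {s : Fin N → ℝ} (hs : s ∈ convexHull ℝ U) (i : Fin N) : s i ∈ Icc (0 : ℝ) 1 := by
  have h : convexHull ℝ U ⊆ Icc 0 1 := by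
    refine convexHull_min (fun s hs => ⟨fun j => ?_, fun j => ?_⟩) (convex_Icc 0 1) <;>
      rcases hU s hs j with h | h <;> simp [h]
  exact ⟨(h hs).1 i, (h hs).2 i⟩

lemma boolVec_image_zero_or_one {S : Set (Fin N → Bool)} :
    ∀ s ∈ boolVec '' S, ∀ i, s i = 0 ∨ s i = 1 := by
  rintro _ ⟨b, -, rfl⟩ i
  by_cases h : b i <;> simp [boolVec, h]

lemma exp_fAlpha_le_expF {α : ℝ} (hα : 0 < α) (C : Set Ω) (A : Set (Fin N → Ω))
    (x : Fin N → Ω) : ENNReal.ofReal (Real.exp (fAlpha α A x)) ≤ expF α C A x := by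
  refine le_iInf fun s => ENNReal.ofReal_le_ofReal (Real.exp_le_exp.2 ?_)
  have hs : s.1 ∈ convexHull ℝ (convUA A x) := by
    refine convexHull_mono ?_ s.2
    rintro _ ⟨b, hb, rfl⟩
    exact boolVec_mem_convUA hb
  refine ciInf_le ⟨0, ?_⟩ (⟨s.1, hs⟩ : convexHull ℝ (convUA A x))
  rintro _ ⟨t, rfl⟩
  exact Finset.sum_nonneg fun i _ =>
    xiTal_nonneg hα (mem_Icc_of_mem_convexHull (fun s hs => hs.1) t.2 i)

lemma expF_anti {α : ℝ} {C C' : Set Ω} (h : C ⊆ C') (A : Set (Fin N → Ω)) (x : Fin N → Ω) :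
    expF α C' A x ≤ expF α C A x := by
  have hS : boolVec '' replSet C A x ⊆ boolVec '' replSet C' A x :=
    image_mono fun b ⟨c, hc, hA⟩ => ⟨c, fun i => h (hc i), hA⟩
  refine le_iInf fun s => ?_
  exact iInf_le (fun s : convexHull ℝ (boolVec '' replSet C' A x) =>
    ENNReal.ofReal (Real.exp (∑ i, xiTal α (s.1 i)))) ⟨s.1, convexHull_mono hS s.2⟩

lemma measurable_expF {X : Type*} [MeasurableSpace X] [MeasurableSpace Ω] (α : ℝ) {C : Set Ω}
    (hC : C.Countable) {A : X → Set (Fin N → Ω)} {x : X → Fin N → Ω} (hx : Measurable x)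
    (hA : MeasurableSet {z : X × (Fin N → Ω) | z.2 ∈ A z.1}) :
    Measurable fun z => expF α C (A z) (x z) := by
  have h1 : Measurable fun z => replSet C (A z) (x z) := by
    refine measurable_set_iff.2 fun b => measurableSet_setOfPred.1 ?_
    have hc : {c : Fin N → Ω | ∀ i, c i ∈ C}.Countable := by
      have := Set.countable_univ_pi (fun _ : Fin N => hC)
      simpa [Set.pi] using this
    have e : {z | b ∈ replSet C (A z) (x z)} = ⋃ c ∈ {c : Fin N → Ω | ∀ i, c i ∈ C},
        (fun z => (z, fun i => if b i then c i else x z i)) ⁻¹'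
          {z : X × (Fin N → Ω) | z.2 ∈ A z.1} := by
      ext z
      simp [replSet]
    rw [e]
    refine MeasurableSet.biUnion hc fun c _ => hA.preimage ?_
    refine measurable_id.prodMk (measurable_pi_lambda _ fun i => ?_)
    by_cases h : b i
    · simp [h]
    · simpa [h] using measurable_pi_iff.1 hx i
  have : MeasurableSingletonClass (Set (Fin N → Bool)) :=
    inferInstanceAs (MeasurableSingletonClass ((Fin N → Bool) → Prop))
  exact (measurable_of_finite (expInf α)).comp h1

lemma cons_mem_convexHull_of_mem {e : ℝ} {U : Set (Fin N → ℝ)} {V : Set (Fin (N + 1) → ℝ)}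
    (h : ∀ s ∈ U, (Fin.cons e s : Fin (N + 1) → ℝ) ∈ V) {s : Fin N → ℝ}
    (hs : s ∈ convexHull ℝ U) : (Fin.cons e s : Fin (N + 1) → ℝ) ∈ convexHull ℝ V := by
  have hconv : Convex ℝ {s : Fin N → ℝ | (Fin.cons e s : Fin (N + 1) → ℝ) ∈ convexHull ℝ V} := by
    intro s hs t ht a b ha hb hab
    have := convex_convexHull ℝ V hs ht ha hb hab
    have heq : (Fin.cons e (a • s + b • t) : Fin (N + 1) → ℝ)
        = a • (Fin.cons e s : Fin (N + 1) → ℝ) + b • (Fin.cons e t : Fin (N + 1) → ℝ) := by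
      ext i
      refine Fin.cases ?_ (fun j => ?_) i
      · simp [← add_mul, hab]
      · simp
    rw [mem_ofPred_eq, heq]
    exact this
  have hsub : U ⊆ {s : Fin N → ℝ | (Fin.cons e s : Fin (N + 1) → ℝ) ∈ convexHull ℝ V} :=
    fun t ht => subset_convexHull ℝ V (h t ht)
  exact convexHull_min hsub hconv hs

lemma boolVec_cons (e : Bool) (b : Fin N → Bool) :
    boolVec (Fin.cons e b : Fin (N + 1) → Bool) = Fin.cons (if e then 1 else 0) (boolVec b) := by
  ext i
  refine Fin.cases ?_ (fun j => ?_) i <;> simp [boolVec]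

lemma cons_false_mem_replSet {C : Set Ω} (hC : C.Nonempty) {A : Set (Fin (N + 1) → Ω)} {ω : Ω}
    {x : Fin N → Ω} {b : Fin N → Bool}
    (hb : b ∈ replSet C {x | (Fin.cons ω x : Fin (N + 1) → Ω) ∈ A} x) :
    (Fin.cons false b : Fin (N + 1) → Bool) ∈ replSet C A (Fin.cons ω x) := by
  obtain ⟨c, hc, hA⟩ := hb
  obtain ⟨w, hw⟩ := hC
  refine ⟨Fin.cons w c, Fin.cases hw hc, ?_⟩
  rw [mem_ofPred_eq] at hA
  convert hA using 1
  ext i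
  refine Fin.cases ?_ (fun j => ?_) i <;> simp

lemma cons_true_mem_replSet {C : Set Ω} {A : Set (Fin (N + 1) → Ω)} {ω w : Ω} (hw : w ∈ C)
    {x : Fin N → Ω} {b : Fin N → Bool}
    (hb : b ∈ replSet C {x | (Fin.cons w x : Fin (N + 1) → Ω) ∈ A} x) :
    (Fin.cons true b : Fin (N + 1) → Bool) ∈ replSet C A (Fin.cons ω x) := by
  obtain ⟨c, hc, hA⟩ := hb
  refine ⟨Fin.cons w c, Fin.cases hw hc, ?_⟩
  rw [mem_ofPred_eq] at hA
  convert hA using 1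
  ext i
  refine Fin.cases ?_ (fun j => ?_) i <;> simp

lemma cons_zero_mem {C : Set Ω} (hC : C.Nonempty) {A : Set (Fin (N + 1) → Ω)} {ω : Ω}
    {x : Fin N → Ω} {s : Fin N → ℝ}
    (hs : s ∈ convexHull ℝ
      (boolVec '' replSet C {x | (Fin.cons ω x : Fin (N + 1) → Ω) ∈ A} x)) :
    (Fin.cons 0 s : Fin (N + 1) → ℝ) ∈
      convexHull ℝ (boolVec '' replSet C A (Fin.cons ω x)) := by
  refine cons_mem_convexHull_of_mem ?_ hs
  rintro _ ⟨b, hb, rfl⟩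
  exact ⟨_, cons_false_mem_replSet hC hb, by simp [boolVec_cons]⟩

lemma cons_one_mem {C : Set Ω} {A : Set (Fin (N + 1) → Ω)} {ω w : Ω} (hw : w ∈ C)
    {x : Fin N → Ω} {t : Fin N → ℝ}
    (ht : t ∈ convexHull ℝ
      (boolVec '' replSet C {x | (Fin.cons w x : Fin (N + 1) → Ω) ∈ A} x)) :
    (Fin.cons 1 t : Fin (N + 1) → ℝ) ∈
      convexHull ℝ (boolVec '' replSet C A (Fin.cons ω x)) := by
  refine cons_mem_convexHull_of_mem ?_ ht
  rintro _ ⟨b, hb, rfl⟩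
  exact ⟨_, cons_true_mem_replSet hw hb, by simp [boolVec_cons]⟩

lemma cons_combo_mem {C : Set Ω} {A : Set (Fin (N + 1) → Ω)} {ω w : Ω} (hw : w ∈ C)
    {x : Fin N → Ω} {l : ℝ} (hl : l ∈ Icc (0 : ℝ) 1) {s t : Fin N → ℝ}
    (hs : s ∈ convexHull ℝ
      (boolVec '' replSet C {x | (Fin.cons ω x : Fin (N + 1) → Ω) ∈ A} x))
    (ht : t ∈ convexHull ℝ
      (boolVec '' replSet C {x | (Fin.cons w x : Fin (N + 1) → Ω) ∈ A} x)) :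
    (Fin.cons (1 - l) (l • s + (1 - l) • t) : Fin (N + 1) → ℝ) ∈
      convexHull ℝ (boolVec '' replSet C A (Fin.cons ω x)) := by
  have h := convex_convexHull ℝ _ (cons_zero_mem ⟨w, hw⟩ hs) (cons_one_mem (ω := ω) hw ht)
    hl.1 (sub_nonneg.2 hl.2) (add_sub_cancel _ _)
  convert h using 1
  ext i
  refine Fin.cases ?_ (fun j => ?_) i <;> simp

lemma expF_le_of_mem {α : ℝ} {C : Set Ω} {A : Set (Fin N → Ω)} {x : Fin N → Ω} {v : Fin N → ℝ}
    (hv : v ∈ convexHull ℝ (boolVec '' replSet C A x)) :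
    expF α C A x ≤ ENNReal.ofReal (Real.exp (∑ i, xiTal α (v i))) :=
  iInf_le (fun s : convexHull ℝ (boolVec '' replSet C A x) =>
    ENNReal.ofReal (Real.exp (∑ i, xiTal α (s.1 i)))) ⟨v, hv⟩

lemma one_le_expInf {α : ℝ} (hα : 0 < α) (S : Set (Fin N → Bool)) : 1 ≤ expInf α S := by
  refine le_iInf fun s => ?_
  rw [← ENNReal.ofReal_one]
  exact ENNReal.ofReal_le_ofReal (Real.one_le_exp (Finset.sum_nonneg fun i _ =>
    xiTal_nonneg hα (mem_Icc_of_mem_convexHull boolVec_image_zero_or_one s.2 i)))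

lemma le_mul_iInf_rpow_mul_iInf_rpow {ι κ : Type*} {f : ι → ℝ≥0∞} {g : κ → ℝ≥0∞}
    {a c : ℝ≥0∞} (hc0 : c ≠ 0) (hc : c ≠ ∞) {l : ℝ} (hl0 : 0 < l) (hl1 : l < 1)
    (hf : ⨅ i, f i ≠ 0) (hg : ⨅ j, g j ≠ 0) (h : ∀ i j, a ≤ c * f i ^ l * g j ^ (1 - l)) :
    a ≤ c * (⨅ i, f i) ^ l * (⨅ j, g j) ^ (1 - l) := by
  have hl1' : 0 < 1 - l := sub_pos.2 hl1
  by_cases hf' : ⨅ i, f i = ∞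
  · rw [hf', ENNReal.top_rpow_of_pos hl0, ENNReal.mul_top hc0, ENNReal.top_mul]
    · exact le_top
    · simp [hg, hl1'.not_gt]
  by_cases hg' : ⨅ j, g j = ∞
  · rw [hg', ENNReal.top_rpow_of_pos hl1', ENNReal.mul_top]
    · exact le_top
    · simp [hc0, hf, hl0.not_gt]
  have ef : (⨅ i, f i) ^ l = ⨅ i, f i ^ l := (ENNReal.orderIsoRpow l hl0).map_iInf f
  have eg : (⨅ j, g j) ^ (1 - l) = ⨅ j, g j ^ (1 - l) :=
    (ENNReal.orderIsoRpow (1 - l) hl1').map_iInf g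
  obtain ⟨i, hi⟩ : ∃ i, f i ≠ ∞ := by
    by_contra! hh
    exact hf' (by simp [hh])
  obtain ⟨j, hj⟩ : ∃ j, g j ≠ ∞ := by
    by_contra! hh
    exact hg' (by simp [hh])
  rw [ef, eg, ENNReal.mul_iInf_of_ne hc0 hc]
  exact ENNReal.le_iInf_mul_iInf
    ⟨i, ENNReal.mul_ne_top hc (ENNReal.rpow_ne_top_of_nonneg hl0.le hi)⟩
    ⟨j, ENNReal.rpow_ne_top_of_nonneg hl1'.le hj⟩ h

lemma expF_cons_le {α : ℝ} (hα : 0 < α) {C : Set Ω} (A : Set (Fin (N + 1) → Ω)) (ω : Ω) {w : Ω}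
    (hw : w ∈ C) (x : Fin N → Ω) {l : ℝ} (hl : l ∈ Icc (0 : ℝ) 1) :
    expF α C A (Fin.cons ω x) ≤ ENNReal.ofReal (Real.exp (xiTal α (1 - l)))
      * expF α C {x | (Fin.cons ω x : Fin (N + 1) → Ω) ∈ A} x ^ l
      * expF α C {x | (Fin.cons w x : Fin (N + 1) → Ω) ∈ A} x ^ (1 - l) := by
  have hc0 (r : ℝ) : ENNReal.ofReal (Real.exp r) ≠ 0 := by
    simpa using Real.exp_pos r
  have hc (r : ℝ) : ENNReal.ofReal (Real.exp r) ≠ ∞ := ENNReal.ofReal_ne_top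
  rcases hl.1.eq_or_lt with rfl | hl0
  · rw [ENNReal.rpow_zero, mul_one, _root_.sub_zero, ENNReal.rpow_one]
    refine (le_iInf fun t => ?_).trans_eq (ENNReal.mul_iInf_of_ne (hc0 _) (hc _)).symm
    refine (expF_le_of_mem (cons_one_mem hw t.2)).trans_eq ?_
    rw [← ENNReal.ofReal_mul (Real.exp_pos _).le, ← Real.exp_add]
    simp [Fin.sum_univ_succ]
  rcases hl.2.eq_or_lt with rfl | hl1
  · rw [_root_.sub_self, ENNReal.rpow_zero, mul_one, ENNReal.rpow_one]
    refine (le_iInf fun s => ?_).trans_eq (ENNReal.mul_iInf_of_ne (hc0 _) (hc _)).symm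
    refine (expF_le_of_mem (cons_zero_mem ⟨w, hw⟩ s.2)).trans_eq ?_
    rw [← ENNReal.ofReal_mul (Real.exp_pos _).le, ← Real.exp_add]
    simp [Fin.sum_univ_succ]
  refine le_mul_iInf_rpow_mul_iInf_rpow (hc0 _) (hc _) hl0 hl1
    (one_pos.trans_le (one_le_expInf hα _)).ne' (one_pos.trans_le (one_le_expInf hα _)).ne'
    fun s t => (expF_le_of_mem (cons_combo_mem hw hl s.2 t.2)).trans ?_
  rw [ENNReal.ofReal_rpow_of_pos (Real.exp_pos _), ENNReal.ofReal_rpow_of_pos (Real.exp_pos _),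
    ← ENNReal.ofReal_mul (Real.exp_pos _).le, ← Real.exp_mul, ← Real.exp_mul, ← Real.exp_add,
    ← ENNReal.ofReal_mul (Real.exp_pos _).le, ← Real.exp_add]
  refine ENNReal.ofReal_le_ofReal (Real.exp_le_exp.2 ?_)
  have key : ∑ i, xiTal α (l * s.1 i + (1 - l) * t.1 i)
      ≤ ∑ i, (l * xiTal α (s.1 i) + (1 - l) * xiTal α (t.1 i)) :=
    Finset.sum_le_sum fun i _ => (convexOn_xiTal hα).2
      (mem_Icc_of_mem_convexHull boolVec_image_zero_or_one s.2 i)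
      (mem_Icc_of_mem_convexHull boolVec_image_zero_or_one t.2 i)
      hl0.le (sub_pos.2 hl1).le (add_sub_cancel _ _)
  rw [Finset.sum_add_distrib, ← Finset.mul_sum, ← Finset.mul_sum] at key
  simp only [Fin.sum_univ_succ, Fin.cons_zero, Fin.cons_succ, Pi.add_apply, Pi.smul_apply,
    smul_eq_mul]
  linarith

lemma expF_fin_zero {α : ℝ} (C : Set Ω) {A : Set (Fin 0 → Ω)} {x : Fin 0 → Ω} (hx : x ∈ A) :
    expF α C A x = 1 := by
  have hb : (fun i => i.elim0 : Fin 0 → Bool) ∈ replSet C A x :=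
    ⟨x, fun i => i.elim0, by convert hx⟩
  refine le_antisymm ((expF_le_of_mem (subset_convexHull ℝ _ ⟨_, hb, rfl⟩)).trans_eq (by simp)) ?_
  exact le_iInf fun s => by simp

end mixed

section induction

variable {Ω : Type*} [MeasurableSpace Ω] {N : ℕ}

instance isProbabilityMeasure_piP (μ : Measure Ω) [IsProbabilityMeasure μ] :
    IsProbabilityMeasure (piP μ N) :=
  inferInstanceAs (IsProbabilityMeasure (Measure.pi fun _ : Fin N => μ))

lemma measurePreserving_finCons (μ : Measure Ω) [IsProbabilityMeasure μ] :
    MeasurePreserving (fun p : Ω × (Fin N → Ω) => (Fin.cons p.1 p.2 : Fin (N + 1) → Ω))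
      (μ.prod (piP μ N)) (piP μ (N + 1)) := by
  have h := (measurePreserving_piFinSuccAbove (fun _ : Fin (N + 1) => μ) 0).symm
  have e : (fun p : Ω × (Fin N → Ω) => (Fin.cons p.1 p.2 : Fin (N + 1) → Ω))
      = (MeasurableEquiv.piFinSuccAbove (fun _ : Fin (N + 1) => Ω) 0).symm :=
    funext fun p => (Fin.insertNth_zero' p.1 p.2).symm
  rw [e]
  exact h

lemma lintegral_piP_succ (μ : Measure Ω) [IsProbabilityMeasure μ] {f : (Fin (N + 1) → Ω) → ℝ≥0∞}
    (hf : Measurable f) : ∫⁻ y, f y ∂piP μ (N + 1)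
      = ∫⁻ ω, ∫⁻ x, f (Fin.cons ω x) ∂piP μ N ∂μ := by
  rw [← (measurePreserving_finCons μ).lintegral_comp hf]
  exact lintegral_prod _ (hf.comp (measurePreserving_finCons μ).measurable).aemeasurable

lemma piP_succ_apply (μ : Measure Ω) [IsProbabilityMeasure μ] {A : Set (Fin (N + 1) → Ω)}
    (hA : MeasurableSet A) : piP μ (N + 1) A
      = ∫⁻ ω, piP μ N {x | (Fin.cons ω x : Fin (N + 1) → Ω) ∈ A} ∂μ := by
  rw [← (measurePreserving_finCons μ).measure_preimage hA.nullMeasurableSet,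
    Measure.prod_apply ((measurePreserving_finCons μ).measurable hA)]
  rfl

lemma measurable_expF_const (α : ℝ) {C : Set Ω} (hC : C.Countable) {A : Set (Fin N → Ω)}
    (hA : MeasurableSet A) : Measurable (expF α C A) :=
  measurable_expF α hC (A := fun _ => A) measurable_id (hA.preimage measurable_snd)

/-- A measurable set of `T × Ω` is met, on almost every section of positive measure, by one
countable set of points of `Ω`. -/
lemma exists_countable_forall_ae_mem {T : Type*} [MeasurableSpace T] (ν : Measure T)
    [IsProbabilityMeasure ν] (μ : Measure Ω) [IsProbabilityMeasure μ] {D : Set (T × Ω)}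
    (hD : MeasurableSet D) :
    ∃ C : Set Ω, C.Countable ∧
      ∀ᵐ t ∂ν, 0 < μ {ω | (t, ω) ∈ D} → ∃ w ∈ C, (t, w) ∈ D := by
  let cov (C : Set Ω) : Set T := ⋃ w ∈ C, {t | (t, w) ∈ D}
  have hcov {C : Set Ω} (hC : C.Countable) : MeasurableSet (cov C) :=
    MeasurableSet.biUnion hC fun w _ => measurable_prodMk_right hD
  let S : Set ℝ≥0∞ := (fun C => ν (cov C)) '' {C | C.Countable}
  obtain ⟨u, -, hu, huS⟩ := exists_seq_tendsto_sSup (S := S)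
    ⟨_, ∅, countable_empty, rfl⟩ (OrderTop.bddAbove S)
  choose c hc hcu using huS
  have hE : (⋃ n, c n).Countable := countable_iUnion hc
  have hmax : sSup S ≤ ν (cov (⋃ n, c n)) := by
    refine le_of_tendsto' hu fun n => ?_
    rw [← hcu n]
    exact measure_mono (biUnion_subset_biUnion_left (subset_iUnion c n))
  refine ⟨⋃ n, c n, hE, ?_⟩
  have hzero (w : Ω) : ν ({t | (t, w) ∈ D} \ cov (⋃ n, c n)) = 0 := by
    have h1 : cov (insert w (⋃ n, c n)) = {t | (t, w) ∈ D} ∪ cov (⋃ n, c n) :=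
      biUnion_insert _ _ _
    have hmem : ν (cov (insert w (⋃ n, c n))) ∈ S := ⟨_, hE.insert w, rfl⟩
    have h2 := (le_sSup hmem).trans hmax
    rw [h1, ← sdiff_union_self, measure_union disjoint_sdiff_left (hcov hE)] at h2
    by_contra h
    exact (ENNReal.lt_add_right (measure_ne_top ν (cov (⋃ n, c n))) h).not_ge
      (by rwa [add_comm])
  have hD' : MeasurableSet (D \ Prod.fst ⁻¹' cov (⋃ n, c n)) :=
    hD.diff (measurable_fst (hcov hE))
  have hnull : (ν.prod μ) (D \ Prod.fst ⁻¹' cov (⋃ n, c n)) = 0 := by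
    rw [Measure.prod_apply_symm hD']
    simp only [lintegral_eq_zero_iff (measurable_measure_prodMk_right hD')]
    exact Eventually.of_forall hzero
  rw [Measure.measure_prod_null hD'] at hnull
  filter_upwards [hnull] with t ht hpos
  rw [Pi.zero_apply] at ht
  by_contra! hne
  refine hpos.ne' ?_
  convert ht using 2
  ext ω
  simp only [mem_ofPred_eq, mem_preimage, Set.mem_sdiff, iff_self_and]
  intro _ hmem
  obtain ⟨w, hw, hw'⟩ := mem_iUnion₂.1 hmem
  exact hne w hw hw'

lemma lintegral_expF_cons_le {α : ℝ} (hα : 0 < α) (μ : Measure Ω) [IsProbabilityMeasure μ]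
    {A : Set (Fin (N + 1) → Ω)} (hA : MeasurableSet A) {C : Set Ω} (hC : C.Countable) (ω : Ω)
    {w : Ω} (hw : w ∈ C) {l : ℝ} (hl : l ∈ Icc (0 : ℝ) 1) :
    ∫⁻ x, expF α C A (Fin.cons ω x) ∂piP μ N ≤ ENNReal.ofReal (Real.exp (xiTal α (1 - l)))
      * (∫⁻ x, expF α C {x | (Fin.cons ω x : Fin (N + 1) → Ω) ∈ A} x ∂piP μ N) ^ l
      * (∫⁻ x, expF α C {x | (Fin.cons w x : Fin (N + 1) → Ω) ∈ A} x ∂piP μ N) ^ (1 - l) := by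
  have hm (ω : Ω) : Measurable (expF α C {x | (Fin.cons ω x : Fin (N + 1) → Ω) ∈ A}) :=
    measurable_expF_const α hC
      (hA.preimage ((measurePreserving_finCons μ).measurable.comp measurable_prodMk_left))
  refine (lintegral_mono fun x => expF_cons_le hα A ω hw x hl).trans ?_
  simp only [mul_assoc]
  refine (lintegral_const_mul _ (((hm ω).pow_const l).mul ((hm w).pow_const (1 - l)))).trans_le ?_
  gcongr
  exact ENNReal.lintegral_mul_norm_pow_le (hm ω).aemeasurable (hm w).aemeasurable hl.1
    (sub_nonneg.2 hl.2) (add_sub_cancel _ _)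

lemma rpow_neg_mul_le {α : ℝ} (hα : 0 < α) {p M : ℝ≥0∞} (hp : p ≠ 0) (hpM : p ≤ M)
    (hM : M ≠ ∞) :
    M ^ (-α) * ENNReal.ofReal (1 + α - α * (p / M).toReal) ≤ p ^ (-α) := by
  have hM0 : M ≠ 0 := fun h => hp (le_zero_iff.1 (h ▸ hpM))
  have hp' : p ≠ ∞ := ne_top_of_le_ne_top hM hpM
  have hq0 : p / M ≠ 0 := ENNReal.div_ne_zero.2 ⟨hp, hM⟩
  have hq : p / M ≠ ∞ := ENNReal.div_ne_top hp' hM0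
  have e : p = M * (p / M) := (ENNReal.mul_div_cancel hM0 hM).symm
  conv_rhs => rw [e, ENNReal.mul_rpow_of_ne_zero hM0 hq0]
  gcongr
  have hpos : 0 < (p / M).toReal := ENNReal.toReal_pos hq0 hq
  refine (ENNReal.ofReal_le_ofReal (one_add_sub_le_rpow_neg hα hpos)).trans_eq ?_
  rw [← ENNReal.ofReal_rpow_of_pos hpos, ENNReal.ofReal_toReal hq]

lemma lintegral_expF_succ_le {α : ℝ} (hα : 0 < α) (μ : Measure Ω) [IsProbabilityMeasure μ]
    {A : Set (Fin (N + 1) → Ω)} (hA : MeasurableSet A) {C : Set Ω} (hC : C.Countable)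
    {p : Ω → ℝ≥0∞} (hp : ∀ ω, p ω = piP μ N {x | (Fin.cons ω x : Fin (N + 1) → Ω) ∈ A})
    (h1 : ∀ᵐ ω ∂μ, ∫⁻ x, expF α C {x | (Fin.cons ω x : Fin (N + 1) → Ω) ∈ A} x ∂piP μ N
      ≤ p ω ^ (-α))
    (h2 : ∀ q < essSup p μ, ∃ w ∈ C, q < p w ∧
      ∫⁻ x, expF α C {x | (Fin.cons w x : Fin (N + 1) → Ω) ∈ A} x ∂piP μ N ≤ p w ^ (-α)) :
    ∫⁻ y, expF α C A y ∂piP μ (N + 1) ≤ piP μ (N + 1) A ^ (-α) := by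
  have hpm : Measurable p := by
    simp only [funext hp]
    exact measurable_measure_prodMk_left ((measurePreserving_finCons μ).measurable hA)
  have hP : piP μ (N + 1) A = ∫⁻ ω, p ω ∂μ := by simp only [piP_succ_apply μ hA, hp]
  rw [lintegral_piP_succ μ (measurable_expF_const α hC hA)]
  set M := essSup p μ
  have hpM : ∀ᵐ ω ∂μ, p ω ≤ M := ENNReal.ae_le_essSup p
  have hM1 : M ≤ 1 := essSup_le_of_ae_le _ (Eventually.of_forall fun ω => by
    rw [hp]; exact prob_le_one)
  have hMtop : M ≠ ∞ := ne_top_of_le_ne_top one_ne_top hM1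
  by_cases hP0 : piP μ (N + 1) A = 0
  · rw [hP0, ENNReal.zero_rpow_of_neg (neg_lt_zero.2 hα)]
    exact le_top
  have hPM : ∫⁻ ω, p ω ∂μ ≤ M := by
    simpa using lintegral_mono_ae hpM
  have hM0 : M ≠ 0 := fun h => hP0 (by rw [hP]; exact le_zero_iff.1 (h ▸ hPM))
  have hpt : ∀ᵐ ω ∂μ, ∫⁻ x, expF α C A (Fin.cons ω x) ∂piP μ N
      ≤ M ^ (-α) * ENNReal.ofReal (1 + α - α * (p ω / M).toReal) := by
    filter_upwards [h1, hpM] with ω hω hωM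
    obtain ⟨l, hl, hle⟩ := exists_weight_le hα hωM hM0 hMtop
    refine le_trans ?_ hle
    set c := ENNReal.ofReal (Real.exp (xiTal α (1 - l))) * (p ω ^ (-α)) ^ l
    have hq : ∀ q < M, ∫⁻ x, expF α C A (Fin.cons ω x) ∂piP μ N
        ≤ c * (q ^ (-α)) ^ (1 - l) := by
      intro q hq
      obtain ⟨w, hw, hqw, hwle⟩ := h2 q hq
      refine (lintegral_expF_cons_le hα μ hA hC ω hw hl).trans ?_
      have hqp : p w ^ (-α) ≤ q ^ (-α) := by
        rw [ENNReal.rpow_neg, ENNReal.rpow_neg]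
        exact ENNReal.inv_le_inv.2 (ENNReal.rpow_le_rpow hqw.le hα.le)
      have h0 : 0 ≤ 1 - l := sub_nonneg.2 hl.2
      exact mul_le_mul' (mul_le_mul' le_rfl (ENNReal.rpow_le_rpow hω hl.1))
        (ENNReal.rpow_le_rpow (hwle.trans hqp) h0)
    have hlim : Tendsto (fun q : ℝ≥0∞ => c * (q ^ (-α)) ^ (1 - l)) (𝓝[<] M)
        (𝓝 (c * (M ^ (-α)) ^ (1 - l))) := by
      refine ENNReal.Tendsto.const_mul (Tendsto.mono_left ?_ nhdsWithin_le_nhds) (Or.inl ?_)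
      · exact (ENNReal.continuous_rpow_const.comp ENNReal.continuous_rpow_const).tendsto M
      · have : 0 < M ^ (-α) := ENNReal.rpow_pos (pos_iff_ne_zero.2 hM0) hMtop
        have hfin : M ^ (-α) ≠ ∞ := by
          simp [ENNReal.rpow_eq_top_iff, hM0, hMtop]
        exact (ENNReal.rpow_pos this hfin).ne'
    have : (𝓝[<] M).NeBot := nhdsLT_neBot_of_exists_lt ⟨0, pos_iff_ne_zero.2 hM0⟩
    exact ge_of_tendsto hlim (eventually_mem_nhdsWithin.mono fun q hq' => hq q hq')
  refine (lintegral_mono_ae hpt).trans ?_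
  have hrm : Measurable fun ω => (p ω / M).toReal := (hpm.div_const M).ennreal_toReal
  have hr1 : ∀ᵐ ω ∂μ, (p ω / M).toReal ≤ 1 := by
    filter_upwards [hpM] with ω hω
    exact ENNReal.toReal_le_of_le_ofReal zero_le_one
      (by simpa using ENNReal.div_le_of_le_mul (by simpa using hω))
  have hri : Integrable (fun ω => (p ω / M).toReal) μ :=
    Integrable.of_bound hrm.aestronglyMeasurable 1 (by
      filter_upwards [hr1] with ω hω
      rwa [Real.norm_of_nonneg ENNReal.toReal_nonneg])
  have hrint : ∫ ω, (p ω / M).toReal ∂μ = ((∫⁻ ω, p ω ∂μ) / M).toReal := by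
    rw [integral_toReal (hpm.div_const M).aemeasurable
      (by filter_upwards [hpM] with ω hω
          exact ENNReal.div_lt_top (ne_top_of_le_ne_top hMtop hω) hM0)]
    simp only [div_eq_mul_inv]
    rw [lintegral_mul_const _ hpm]
  have hint : ∫⁻ ω, ENNReal.ofReal (1 + α - α * (p ω / M).toReal) ∂μ
      = ENNReal.ofReal (1 + α - α * ((∫⁻ ω, p ω ∂μ) / M).toReal) := by
    have hsub : Integrable (fun ω => 1 + α - α * (p ω / M).toReal) μ :=
      (integrable_const _).sub (hri.const_mul α)
    rw [← ofReal_integral_eq_lintegral_ofReal hsub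
      (by filter_upwards [hr1] with ω hω
          simp only [Pi.zero_apply]
          nlinarith), integral_sub (integrable_const _) (hri.const_mul α), integral_const_mul,
      hrint]
    simp
  rw [lintegral_const_mul _ (by fun_prop), hint, hP]
  exact rpow_neg_mul_le hα (hP ▸ hP0) hPM hMtop

end induction

section main

universe u

variable {Ω : Type u} [MeasurableSpace Ω]

lemma lintegral_expF_fin_zero_le {α : ℝ} (hα : 0 < α) (μ : Measure Ω) [IsProbabilityMeasure μ]
    (C : Set Ω) (A : Set (Fin 0 → Ω)) :
    ∫⁻ x, expF α C A x ∂piP μ 0 ≤ piP μ 0 A ^ (-α) := by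
  rcases A.eq_empty_or_nonempty with rfl | hA
  · rw [measure_empty, ENNReal.zero_rpow_of_neg (neg_lt_zero.2 hα)]
    exact le_top
  · have hA' : A = univ := Subsingleton.eq_univ_of_nonempty hA
    subst hA'
    simp [expF_fin_zero C (mem_univ _)]

/-- A parametric form of the inequality: the replacement values are taken in one countable set that
works for almost all values of the parameter. -/
lemma exists_countable_lintegral_expF_le {α : ℝ} (hα : 0 < α) (μ : Measure Ω)
    [IsProbabilityMeasure μ] (N : ℕ) {T : Type u} [MeasurableSpace T] (ν : Measure T)
    [IsProbabilityMeasure ν] {A : Set (T × (Fin N → Ω))} (hA : MeasurableSet A) :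
    ∃ C : Set Ω, C.Countable ∧ ∀ᵐ t ∂ν,
      ∫⁻ x, expF α C {x | (t, x) ∈ A} x ∂piP μ N ≤ piP μ N {x | (t, x) ∈ A} ^ (-α) := by
  induction N generalizing T with
  | zero =>
    exact ⟨∅, countable_empty, Eventually.of_forall fun t => lintegral_expF_fin_zero_le hα μ ∅ _⟩
  | succ N ih =>
    have hcons : Measurable fun z : (T × Ω) × (Fin N → Ω) =>
        (z.1.1, (Fin.cons z.1.2 z.2 : Fin (N + 1) → Ω)) :=
      (measurable_fst.comp measurable_fst).prodMk ((measurePreserving_finCons μ).measurable.comp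
        ((measurable_snd.comp measurable_fst).prodMk measurable_snd))
    have hB := hcons hA
    obtain ⟨C₀, hC₀, h₀⟩ := ih (ν.prod μ) hB
    let p : T × Ω → ℝ≥0∞ := fun z =>
      piP μ N {x | (z.1, (Fin.cons z.2 x : Fin (N + 1) → Ω)) ∈ A}
    have hp : Measurable p := measurable_measure_prodMk_left hB
    let I : T × Ω → ℝ≥0∞ := fun z =>
      ∫⁻ x, expF α C₀ {x | (z.1, (Fin.cons z.2 x : Fin (N + 1) → Ω)) ∈ A} x ∂piP μ N
    have hI : Measurable I := by
      refine Measurable.lintegral_prod_right' (f := fun z : (T × Ω) × (Fin N → Ω) =>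
        expF α C₀ {x | (z.1.1, (Fin.cons z.1.2 x : Fin (N + 1) → Ω)) ∈ A} z.2) ?_
      have hproj : Measurable fun y : ((T × Ω) × (Fin N → Ω)) × (Fin N → Ω) => (y.1.1, y.2) :=
        (measurable_fst.comp measurable_fst).prodMk measurable_snd
      exact measurable_expF α hC₀ measurable_snd (hproj hB)
    let D : ℚ → Set (T × Ω) := fun q =>
      {z | (Real.toNNReal q : ℝ≥0∞) < p z} ∩ {z | I z ≤ p z ^ (-α)}
    have hD (q : ℚ) : MeasurableSet (D q) :=
      (measurableSet_lt measurable_const hp).inter (measurableSet_le hI (hp.pow_const _))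
    choose C₁ hC₁ h₁ using fun q => exists_countable_forall_ae_mem ν μ (hD q)
    refine ⟨C₀ ∪ ⋃ q, C₁ q, hC₀.union (countable_iUnion hC₁), ?_⟩
    filter_upwards [Measure.ae_ae_of_ae_prod h₀, ae_all_iff.2 h₁] with t ht₀ ht₁
    have hanti (ω : Ω) : ∫⁻ x, expF α (C₀ ∪ ⋃ q, C₁ q)
        {x | (t, (Fin.cons ω x : Fin (N + 1) → Ω)) ∈ A} x ∂piP μ N ≤ I (t, ω) :=
      lintegral_mono fun x => expF_anti subset_union_left _ x
    refine lintegral_expF_succ_le hα μ (hA.preimage measurable_prodMk_left)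
      (hC₀.union (countable_iUnion hC₁)) (p := fun ω => p (t, ω)) (fun ω => rfl) ?_ ?_
    · filter_upwards [ht₀] with ω hω using (hanti ω).trans hω
    · intro q hq
      obtain ⟨r, -, hqr, hr⟩ := ENNReal.lt_iff_exists_rat_btwn.1 hq
      have hpos : 0 < μ {ω | (t, ω) ∈ D r} := by
        rw [pos_iff_ne_zero]
        intro h0
        refine hr.not_ge (essSup_le_of_ae_le _ ?_)
        have h0' : ∀ᵐ ω ∂μ, (t, ω) ∉ D r := measure_eq_zero_iff_ae_notMem.1 h0
        filter_upwards [h0', ht₀] with ω hω hω₀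
        by_contra hlt
        exact hω ⟨not_le.1 hlt, hω₀⟩
      obtain ⟨w, hw, hwD⟩ := ht₁ r hpos
      exact ⟨w, Or.inr (mem_iUnion.2 ⟨r, hw⟩), hqr.trans hwD.1, (hanti w).trans hwD.2⟩

end main

/-- Theorem 4.2.4 of Talagrand: `∫* exp f_α(A,x) dP(x) ≤ P(A)^{-α}`. -/
theorem talagrand_stmt15 {Ω : Type*} [MeasurableSpace Ω] (μ : Measure Ω)
    [IsProbabilityMeasure μ] (N : ℕ) (hN : 1 ≤ N) (α : ℝ) (hα : 0 < α)
    (A : Set (Fin N → Ω)) (hA : MeasurableSet A) (hA0 : 0 < piP μ N A) :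
    upperLintegral (piP μ N) (fun x => ENNReal.ofReal (Real.exp (fAlpha α A x))) ≤
      (piP μ N A ^ α)⁻¹ := by
  have hA' : MeasurableSet {z : PUnit × (Fin N → Ω) | z.2 ∈ A} := hA.preimage measurable_snd
  obtain ⟨C, hC, h⟩ := exists_countable_lintegral_expF_le hα μ N
    (Measure.dirac PUnit.unit) hA'
  obtain ⟨t, ht⟩ := h.exists
  refine (iInf₂_le_of_le (expF α C A) (measurable_expF_const α hC hA)
    (iInf_le _ (exp_fAlpha_le_expF hα C A))).trans ?_
  rw [← ENNReal.rpow_neg]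
  exact ht
end

section
/- Let $(\Omega,\Sigma,\mu)$ be a probability space, $N \ge 1$, and $P = \mu^{\otimes N}$ on $\Omega^N$. Let $L_N : \Omega^N \to \mathbb{N}$ be a measurable configuration function, i.e. for every $x \in \Omega^N$ there exists $J \subseteq \{1,\dots,N\}$ with $\mathrm{card}\, J = L_N(x)$ such that for every $y \in \Omega^N$, $L_N(y) \ge \mathrm{card}\{i \in J : y_i = x_i\}$. Let $M$ be a median of $L_N$ under $P$ (i.e. $P(L_N \ge M) \ge 1/2$ and $P(L_N \le M) \ge 1/2$), with $M > 0$. Then for all $u > 0$: $P(L_N \ge M + u) \le 2\exp\Big(-\frac{u^2}{4(M+u)}\Big)$ and $P(L_N \le M - u) \le 2\exp\Big(-\frac{u^2}{4M}\Big)$. -/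
open MeasureTheory ENNReal

/-- The discrete metric: `0` if `a = b` and `1` otherwise. -/
noncomputable def discreteDist {α : Type*} (a b : α) : ℝ :=
  open Classical in if a = b then 0 else 1

theorem discreteDist_self {α : Type*} (a : α) : discreteDist a a = 0 := if_pos rfl

theorem discreteDist_nonneg {α : Type*} (a b : α) : 0 ≤ discreteDist a b := by
  unfold discreteDist; split_ifs <;> norm_num

theorem discreteDist_le_one {α : Type*} (a b : α) : discreteDist a b ≤ 1 := by
  unfold discreteDist; split_ifs <;> norm_num

theorem discreteDist_map_le {α β : Type*} (f : α → β) (a b : α) :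
    discreteDist (f a) (f b) ≤ discreteDist a b := by
  by_cases h : a = b
  · simp [h, discreteDist_self]
  · exact (discreteDist_le_one _ _).trans_eq (if_neg h).symm

/-- The indicator vector of the coordinates in which `x` and `y` differ. -/
noncomputable def mismatch {ι α : Type*} (x y : ι → α) : ι → ℝ :=
  fun i => discreteDist (x i) (y i)

/-- The section of `A` over the first coordinate `a`. -/
noncomputable def firstSection {α : Type*} [Fintype α] {n : ℕ} (A : Finset (Fin (n + 1) → α))
    (a : α) : Finset (Fin n → α) :=
  open Classical in Finset.univ.filter fun y => (Fin.cons a y : Fin (n + 1) → α) ∈ A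

theorem sum_cons {α β : Type*} [Fintype α] [AddCommMonoid β] {n : ℕ}
    (f : (Fin (n + 1) → α) → β) :
    ∑ x, f x = ∑ a, ∑ y : Fin n → α, f (Fin.cons a y) := by
  rw [← Fintype.sum_prod_type']
  exact (Equiv.sum_comp (Fin.consEquiv fun _ : Fin (n + 1) => α) f).symm

theorem sum_card_firstSection {α : Type*} [Fintype α] {n : ℕ}
    (A : Finset (Fin (n + 1) → α)) : ∑ a, (firstSection A a).card = A.card := by
  classical
  have h : A.card = ∑ x, if x ∈ A then 1 else 0 := by simp
  rw [h, sum_cons]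
  simp [firstSection]

theorem cons_mem_convexHull_mismatch {α : Type*} [Fintype α] {n : ℕ}
    {A : Finset (Fin (n + 1) → α)} {a b : α} {x : Fin n → α} {z : Fin n → ℝ}
    (hz : z ∈ convexHull ℝ (mismatch x '' (firstSection A b : Set (Fin n → α)))) :
    (Fin.cons (discreteDist a b) z : Fin (n + 1) → ℝ) ∈
      convexHull ℝ (mismatch (Fin.cons a x) '' (A : Set (Fin (n + 1) → α))) := by
  set δ := discreteDist a b
  set C := convexHull ℝ (mismatch (Fin.cons a x : Fin (n + 1) → α) '' (A : Set _))
  have hconv : Convex ℝ {z : Fin n → ℝ | (Fin.cons δ z : Fin (n + 1) → ℝ) ∈ C} := by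
    intro z₁ h₁ z₂ h₂ s t hs ht hst
    have h := (convex_convexHull ℝ _ : Convex ℝ C) h₁ h₂ hs ht hst
    change (Fin.cons δ (s • z₁ + t • z₂) : Fin (n + 1) → ℝ) ∈ C
    convert h using 1
    ext i
    refine Fin.cases ?_ (fun i => ?_) i
    · simp [← add_mul, hst]
    · simp
  refine convexHull_min ?_ hconv hz
  rintro _ ⟨y, hy, rfl⟩
  refine subset_convexHull ℝ _ ⟨Fin.cons b y, ?_, ?_⟩
  · simpa [firstSection] using hy
  · ext i
    refine Fin.cases ?_ (fun i => ?_) i <;> rfl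

theorem exp_sub_sq_add_exp_neg_le {t : ℝ} (h0 : 0 ≤ t) (h1 : t ≤ 1 / 2) :
    Real.exp (t - t ^ 2) + Real.exp (-t) ≤ 2 := by
  have hs0 : 0 ≤ t - t ^ 2 := by nlinarith
  have hs1 : t - t ^ 2 ≤ t := by nlinarith [sq_nonneg t]
  have e1 := Real.exp_bound' (x := t - t ^ 2) hs0 (by linarith) (n := 3) (by norm_num)
  have e2 := Real.exp_bound (x := -t) (by rw [abs_neg, abs_of_nonneg h0]; linarith) (n := 4)
    (by norm_num)
  rw [abs_le] at e2
  have e3 := e2.2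
  simp only [Finset.sum_range_succ, Finset.sum_range_zero, abs_neg, abs_of_nonneg h0] at e1 e3
  norm_num [Nat.factorial] at e1 e3
  have h3 : (t - t ^ 2) ^ 3 ≤ t ^ 3 := pow_le_pow_left₀ hs0 hs1 3
  have h4 : t ^ 4 ≤ t ^ 3 / 2 := by nlinarith [pow_nonneg h0 3]
  nlinarith [pow_nonneg h0 3]

theorem exists_exp_sq_le_mul_rpow {r : ℝ} (h0 : 0 < r) (h1 : r ≤ 1) :
    ∃ l : ℝ, 0 ≤ l ∧ l ≤ 1 ∧ Real.exp ((1 - l) ^ 2 / 4) ≤ (2 - r) * r ^ l := by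
  have hlog : Real.log r ≤ 0 := Real.log_nonpos h0.le h1
  rcases le_total (-(1 / 2)) (Real.log r) with h | h
  · refine ⟨1 + 2 * Real.log r, by linarith, by linarith, ?_⟩
    have key := exp_sub_sq_add_exp_neg_le (t := -Real.log r) (by linarith) (by linarith)
    rw [neg_neg, Real.exp_log h0] at key
    rw [Real.rpow_def_of_pos h0]
    calc Real.exp ((1 - (1 + 2 * Real.log r)) ^ 2 / 4)
        = Real.exp (-Real.log r - (-Real.log r) ^ 2) *
            Real.exp (Real.log r * (1 + 2 * Real.log r)) := by
          rw [← Real.exp_add]; ring_nf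
      _ ≤ _ := by gcongr; linarith
  · refine ⟨0, le_rfl, zero_le_one, ?_⟩
    have key := exp_sub_sq_add_exp_neg_le (t := 1 / 2) (by norm_num) le_rfl
    have hr : r ≤ Real.exp (-(1 / 2)) := (Real.log_le_iff_le_exp h0).1 h
    norm_num at key hr ⊢
    linarith

theorem exp_quarter_le_two : Real.exp (1 / 4) ≤ 2 := by
  have key := exp_sub_sq_add_exp_neg_le (t := 1 / 2) (by norm_num) le_rfl
  have := Real.exp_pos (-(1 / 2))
  norm_num at key this ⊢
  linarith

theorem mul_rpow_mul_sum_exp_le {ι : Type*} [Fintype ι] {f g : ι → ℝ} {p q K l : ℝ}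
    (hp : 0 ≤ p) (hq : 0 < q) (hl0 : 0 ≤ l) (hl1 : l ≤ 1)
    (hf : p * ∑ i, Real.exp (f i) ≤ K) (hg : q * ∑ i, Real.exp (g i) ≤ K) :
    q * (p / q) ^ l * ∑ i, Real.exp (l * f i + (1 - l) * g i) ≤ K := by
  have hi (i : ι) : q * (p / q) ^ l * Real.exp (l * f i + (1 - l) * g i) ≤
      l * (p * Real.exp (f i)) + (1 - l) * (q * Real.exp (g i)) := by
    have h := Real.geom_mean_le_arith_mean2_weighted hl0 (sub_nonneg.2 hl1)
      (mul_nonneg hp (Real.exp_nonneg (f i))) (mul_nonneg hq.le (Real.exp_nonneg (g i)))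
      (by ring)
    refine le_of_eq_of_le ?_ h
    rw [Real.mul_rpow hp (Real.exp_nonneg _), Real.mul_rpow hq.le (Real.exp_nonneg _),
      ← Real.exp_mul, ← Real.exp_mul, Real.exp_add, Real.div_rpow hp hq.le,
      Real.rpow_sub hq, Real.rpow_one, mul_comm (f i), mul_comm (g i)]
    ring
  calc _ ≤ ∑ i, (l * (p * Real.exp (f i)) + (1 - l) * (q * Real.exp (g i))) := by
        rw [Finset.mul_sum]; exact Finset.sum_le_sum fun i _ => hi i
    _ = l * (p * ∑ i, Real.exp (f i)) + (1 - l) * (q * ∑ i, Real.exp (g i)) := by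
        simp only [Finset.sum_add_distrib, Finset.mul_sum]
    _ ≤ l * K + (1 - l) * K := by
        have := sub_nonneg.2 hl1
        gcongr
    _ = K := by ring

theorem sum_sq_convexComb_cons_le {n : ℕ} {l δ : ℝ} (hl0 : 0 ≤ l) (hl1 : l ≤ 1) (hδ0 : 0 ≤ δ)
    (hδ1 : δ ≤ 1) (z w : Fin n → ℝ) :
    ∑ i, (l • (Fin.cons 0 z : Fin (n + 1) → ℝ) +
      (1 - l) • (Fin.cons δ w : Fin (n + 1) → ℝ)) i ^ 2 ≤
      l * ∑ i, z i ^ 2 + (1 - l) * ∑ i, w i ^ 2 + (1 - l) ^ 2 := by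
  have hl : 0 ≤ 1 - l := sub_nonneg.2 hl1
  have h0 : ((1 - l) * δ) ^ 2 ≤ (1 - l) ^ 2 :=
    pow_le_pow_left₀ (mul_nonneg hl hδ0) (mul_le_of_le_one_right hl hδ1) 2
  have h1 : ∑ i, (l * z i + (1 - l) * w i) ^ 2 ≤
      l * ∑ i, z i ^ 2 + (1 - l) * ∑ i, w i ^ 2 := by
    rw [Finset.mul_sum, Finset.mul_sum, ← Finset.sum_add_distrib]
    refine Finset.sum_le_sum fun i _ => ?_
    nlinarith [mul_nonneg (mul_nonneg hl0 hl) (sq_nonneg (z i - w i))]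
  rw [Fin.sum_univ_succ]
  simp only [Pi.add_apply, Pi.smul_apply, smul_eq_mul, Fin.cons_zero, Fin.cons_succ]
  linarith

/-- The inductive step of the convex distance inequality, on the slice `{x | x 0 = a}`; `b` is
the first coordinate of a section to interpolate with. -/
theorem exists_mem_convexHull_mismatch_cons {α : Type*} [Fintype α] {n : ℕ} {K : ℝ}
    {A : Finset (Fin (n + 1) → α)} {a b : α} {z : α → (Fin n → α) → (Fin n → ℝ)}
    (hz : ∀ c, (firstSection A c).Nonempty → (∀ x, z c x ∈
      convexHull ℝ (mismatch x '' (firstSection A c : Set (Fin n → α)))) ∧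
      ((firstSection A c).card : ℝ) * ∑ x, Real.exp ((∑ i, z c x i ^ 2) / 4) ≤ K)
    (hb : (firstSection A b).Nonempty)
    (hab : (firstSection A a).card ≤ (firstSection A b).card) :
    ∃ w : (Fin n → α) → (Fin (n + 1) → ℝ),
      (∀ x, w x ∈ convexHull ℝ (mismatch (Fin.cons a x) '' (A : Set (Fin (n + 1) → α)))) ∧
      ((firstSection A b).card : ℝ) * ∑ x, Real.exp ((∑ i, w x i ^ 2) / 4) ≤
        K * (2 - (firstSection A a).card / (firstSection A b).card) := by
  obtain ⟨hzb, hKb⟩ := hz b hb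
  have hq : (0 : ℝ) < (firstSection A b).card := by exact_mod_cast hb.card_pos
  have hK : 0 ≤ K := le_trans (by positivity) hKb
  rcases (firstSection A a).eq_empty_or_nonempty with ha | ha
  · refine ⟨fun x => Fin.cons (discreteDist a b) (z b x),
      fun x => cons_mem_convexHull_mismatch (hzb x), ?_⟩
    have hx (x : Fin n → α) : Real.exp
        ((∑ i, (Fin.cons (discreteDist a b) (z b x) : Fin (n + 1) → ℝ) i ^ 2) / 4) ≤
        2 * Real.exp ((∑ i, z b x i ^ 2) / 4) := by
      have h0 := pow_le_one₀ (n := 2) (discreteDist_nonneg a b) (discreteDist_le_one a b)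
      refine le_trans ?_ (mul_le_mul_of_nonneg_right exp_quarter_le_two (Real.exp_nonneg _))
      rw [← Real.exp_add, Real.exp_le_exp, Fin.sum_univ_succ]
      simp only [Fin.cons_zero, Fin.cons_succ]
      linarith
    calc _ ≤ ((firstSection A b).card : ℝ) * ∑ x, 2 * Real.exp ((∑ i, z b x i ^ 2) / 4) := by
          gcongr with x; exact hx x
      _ = 2 * (((firstSection A b).card : ℝ) * ∑ x, Real.exp ((∑ i, z b x i ^ 2) / 4)) := by
          rw [← Finset.mul_sum]; ring
      _ ≤ 2 * K := by gcongr
      _ = _ := by simp [ha, mul_comm]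
  · obtain ⟨hza, hKa⟩ := hz a ha
    set p : ℝ := ((firstSection A a).card : ℝ)
    set q : ℝ := ((firstSection A b).card : ℝ)
    have hp : 0 < p := Nat.cast_pos.2 ha.card_pos
    have hpq : p / q ≤ 1 := (div_le_one hq).2 (Nat.cast_le.2 hab)
    obtain ⟨l, hl0, hl1, hl⟩ := exists_exp_sq_le_mul_rpow (div_pos hp hq) hpq
    refine ⟨fun x => l • (Fin.cons 0 (z a x) : Fin (n + 1) → ℝ) +
      (1 - l) • (Fin.cons (discreteDist a b) (z b x) : Fin (n + 1) → ℝ), fun x => ?_, ?_⟩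
    · refine convex_convexHull ℝ _ ?_ (cons_mem_convexHull_mismatch (hzb x)) hl0
        (sub_nonneg.2 hl1) (by ring)
      simpa only [discreteDist_self] using cons_mem_convexHull_mismatch (a := a) (hza x)
    have hKl := mul_rpow_mul_sum_exp_le hp.le hq hl0 hl1 hKa hKb
    calc _ ≤ q * ∑ x, Real.exp ((1 - l) ^ 2 / 4) *
          Real.exp (l * ((∑ i, z a x i ^ 2) / 4) + (1 - l) * ((∑ i, z b x i ^ 2) / 4)) := by
          gcongr with x
          rw [← Real.exp_add, Real.exp_le_exp]
          linarith [sum_sq_convexComb_cons_le hl0 hl1 (discreteDist_nonneg a b)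
            (discreteDist_le_one a b) (z a x) (z b x)]
      _ = Real.exp ((1 - l) ^ 2 / 4) * (q * ∑ x, Real.exp
          (l * ((∑ i, z a x i ^ 2) / 4) + (1 - l) * ((∑ i, z b x i ^ 2) / 4))) := by
          rw [← Finset.mul_sum]; ring
      _ ≤ ((2 - p / q) * (p / q) ^ l) * (q * ∑ x, Real.exp
          (l * ((∑ i, z a x i ^ 2) / 4) + (1 - l) * ((∑ i, z b x i ^ 2) / 4))) := by
          gcongr
      _ = (q * (p / q) ^ l * ∑ x, Real.exp
          (l * ((∑ i, z a x i ^ 2) / 4) + (1 - l) * ((∑ i, z b x i ^ 2) / 4))) *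
            (2 - p / q) := by ring
      _ ≤ K * (2 - p / q) := by
          have : 0 ≤ 2 - p / q := by linarith
          gcongr

/-- Talagrand's convex distance inequality for the uniform probability on a finite product. -/
theorem exists_mem_convexHull_mismatch_card_mul_sum_exp_le {α : Type*} [Fintype α] {n : ℕ}
    {A : Finset (Fin n → α)} (hA : A.Nonempty) :
    ∃ z : (Fin n → α) → (Fin n → ℝ),
      (∀ x, z x ∈ convexHull ℝ (mismatch x '' (A : Set (Fin n → α)))) ∧
      (A.card : ℝ) * ∑ x, Real.exp ((∑ i, z x i ^ 2) / 4) ≤ (Fintype.card α : ℝ) ^ (2 * n) := by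
  induction n with
  | zero =>
    obtain ⟨y, hy⟩ := hA
    refine ⟨fun _ => 0, fun x => subset_convexHull ℝ _ ⟨y, hy, Subsingleton.elim _ _⟩, ?_⟩
    simpa using Finset.card_le_univ A
  | succ n ih =>
    have hex (c : α) : ∃ z : (Fin n → α) → (Fin n → ℝ), (firstSection A c).Nonempty →
        (∀ x, z x ∈ convexHull ℝ (mismatch x '' (firstSection A c : Set (Fin n → α)))) ∧
        ((firstSection A c).card : ℝ) * ∑ x, Real.exp ((∑ i, z x i ^ 2) / 4) ≤
          (Fintype.card α : ℝ) ^ (2 * n) := by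
      by_cases hc : (firstSection A c).Nonempty
      · obtain ⟨z, hz⟩ := ih hc
        exact ⟨z, fun _ => hz⟩
      · exact ⟨0, fun h => absurd h hc⟩
    choose z hz using hex
    have : Nonempty α := hA.elim fun y _ => ⟨y 0⟩
    obtain ⟨b, hb⟩ := Finite.exists_max fun a => (firstSection A a).card
    have hbne : (firstSection A b).Nonempty := by
      by_contra h
      have h0 := sum_card_firstSection A
      rw [Finset.not_nonempty_iff_eq_empty] at h
      simp only [h, Finset.card_empty, Nat.le_zero] at hb
      simp only [hb, Finset.sum_const_zero] at h0
      exact hA.card_pos.ne h0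
    choose w hw hwK using fun a => exists_mem_convexHull_mismatch_cons hz hbne (hb a)
    refine ⟨fun x => w (x 0) (Fin.tail x), fun x => ?_, ?_⟩
    · simpa only [Fin.cons_self_tail] using hw (x 0) (Fin.tail x)
    have hq : (0 : ℝ) < (firstSection A b).card := by exact_mod_cast hbne.card_pos
    set q : ℝ := ((firstSection A b).card : ℝ)
    set m : ℝ := (Fintype.card α : ℝ)
    have hcard : ∑ a, ((firstSection A a).card : ℝ) = A.card := by
      exact_mod_cast sum_card_firstSection A
    have hsum : q * ∑ a, ∑ x, Real.exp ((∑ i, w a x i ^ 2) / 4) ≤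
        m ^ (2 * n) * (2 * m - A.card / q) := by
      calc _ ≤ ∑ a, m ^ (2 * n) * (2 - (firstSection A a).card / q) := by
            rw [Finset.mul_sum]; exact Finset.sum_le_sum fun a _ => hwK a
        _ = _ := by
            rw [← Finset.mul_sum, Finset.sum_sub_distrib, ← Finset.sum_div, hcard]
            simp [m, mul_comm]
    rw [sum_cons]
    simp only [Fin.cons_zero, Fin.tail_cons]
    calc _ = A.card / q * (q * ∑ a, ∑ x, Real.exp ((∑ i, w a x i ^ 2) / 4)) := by
          field_simp
      _ ≤ A.card / q * (m ^ (2 * n) * (2 * m - A.card / q)) := by gcongr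
      _ = m ^ (2 * n) * (m ^ 2 - (m - A.card / q) ^ 2) := by ring
      _ ≤ m ^ (2 * n) * m ^ 2 := by
          gcongr
          linarith [sq_nonneg (m - A.card / q)]
      _ = m ^ (2 * (n + 1)) := by ring

theorem card_mul_card_le_of_convexDist {α : Type*} [Fintype α] {n : ℕ}
    {A B : Finset (Fin n → α)} {t : ℝ} (ht : 0 ≤ t)
    (hAB : ∀ x ∈ B, ∃ c : Fin n → ℝ, ∑ i, c i ^ 2 ≤ 1 ∧
      ∀ y ∈ A, t ≤ ∑ i, c i * mismatch x y i) :
    (A.card : ℝ) * B.card ≤ (Fintype.card α : ℝ) ^ (2 * n) * Real.exp (-t ^ 2 / 4) := by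
  rcases A.eq_empty_or_nonempty with rfl | hA
  · simp; positivity
  obtain ⟨z, hz, hK⟩ := exists_mem_convexHull_mismatch_card_mul_sum_exp_le hA
  have hB (x) (hx : x ∈ B) : t ^ 2 ≤ ∑ i, z x i ^ 2 := by
    obtain ⟨c, hc, hct⟩ := hAB x hx
    have hconv : Convex ℝ {v : Fin n → ℝ | t ≤ ∑ i, c i * v i} := by
      refine convex_halfSpace_ge ⟨fun v w => ?_, fun s v => ?_⟩ t
      · simp [mul_add, Finset.sum_add_distrib]
      · simp [Finset.mul_sum, mul_left_comm]
    have htz : t ≤ ∑ i, c i * z x i :=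
      convexHull_min (by rintro _ ⟨y, hy, rfl⟩; exact hct y hy) hconv (hz x)
    calc t ^ 2 ≤ (∑ i, c i * z x i) ^ 2 := pow_le_pow_left₀ ht htz 2
      _ ≤ (∑ i, c i ^ 2) * ∑ i, z x i ^ 2 := Finset.sum_mul_sq_le_sq_mul_sq _ _ _
      _ ≤ 1 * ∑ i, z x i ^ 2 := by gcongr
      _ = _ := one_mul _
  have hsum : (B.card : ℝ) * Real.exp (t ^ 2 / 4) ≤
      ∑ x, Real.exp ((∑ i, z x i ^ 2) / 4) := by
    calc _ = ∑ x ∈ B, Real.exp (t ^ 2 / 4) := by simp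
      _ ≤ ∑ x ∈ B, Real.exp ((∑ i, z x i ^ 2) / 4) :=
          Finset.sum_le_sum fun x hx => by gcongr; exact hB x hx
      _ ≤ _ := Finset.sum_le_univ_sum_of_nonneg fun _ => Real.exp_nonneg _
  rw [neg_div, Real.exp_neg, ← div_eq_mul_inv, le_div_iff₀ (Real.exp_pos _), mul_assoc]
  exact le_trans (by gcongr) hK

theorem measurePreserving_pi_comp_of_injective {ι κ Ω : Type*} [Fintype ι] [Fintype κ]
    [MeasurableSpace Ω] (μ : Measure Ω) [IsProbabilityMeasure μ] {g : κ → ι}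
    (hg : Function.Injective g) :
    MeasurePreserving (fun (ω : ι → Ω) k => ω (g k)) (Measure.pi fun _ => μ)
      (Measure.pi fun _ => μ) := by
  refine ⟨by fun_prop, ?_⟩
  have h := (ProbabilityTheory.iIndepFun_pi (μ := fun _ : ι => μ) (X := fun _ => id)
    fun _ => aemeasurable_id).precomp hg
  refine (h.map_fun_eq_pi_map fun k => (measurable_pi_apply (g k)).aemeasurable).trans ?_
  congr 1 with k : 1
  exact (measurePreserving_eval (fun _ : ι => μ) (g k)).map_eq

theorem pi_inter_comp_eq_mul {ι κ Ω : Type*} [Fintype ι] [Fintype κ]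
    [MeasurableSpace Ω] (μ : Measure Ω) [IsProbabilityMeasure μ] {f g : κ → ι}
    (hf : Function.Injective f) (hg : Function.Injective g) (hfg : ∀ i j, f i ≠ g j)
    {A B : Set (κ → Ω)} (hA : MeasurableSet A) (hB : MeasurableSet B) :
    (Measure.pi fun _ : ι => μ) {ω | (fun k => ω (f k)) ∈ A ∧ (fun k => ω (g k)) ∈ B} =
      (Measure.pi fun _ => μ) A * (Measure.pi fun _ => μ) B := by
  have h := (measurePreserving_sumPiEquivProdPi fun _ : κ ⊕ κ => μ).comp
    (measurePreserving_pi_comp_of_injective μ (hf.sumElim hg hfg))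
  rw [← Measure.prod_prod, ← h.measure_preimage (hA.prod hB).nullMeasurableSet]
  rfl

theorem card_pairwise_ne (N m : ℕ) :
    (Finset.univ.filter fun p : (Fin N → Fin m) × (Fin N → Fin m) =>
      ∀ i, p.1 i ≠ p.2 i).card = (m * m - m) ^ N := by
  classical
  have h : (Finset.univ : Finset (Fin m)).offDiag.card = m * m - m := by
    simp [Finset.offDiag_card]
  have hN : (Fintype.piFinset fun _ : Fin N => (Finset.univ : Finset (Fin m)).offDiag).card =
      (m * m - m) ^ N := by simp [h]
  rw [← hN]
  refine (Finset.card_equiv (Equiv.arrowProdEquivProdArrow _ _ _) fun p => ?_).symm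
  simp [Fintype.mem_piFinset, Equiv.arrowProdEquivProdArrow]

/-- The convex distance inequality, up to a factor that tends to `1` with the sample size `m`:
apply the inequality for finite products to `m` independent samples of each coordinate. -/
theorem pow_mul_measure_mul_measure_le {Ω : Type*} [MeasurableSpace Ω] (μ : Measure Ω)
    [IsProbabilityMeasure μ] {N : ℕ} {A B : Set (Fin N → Ω)} (hA : MeasurableSet A)
    (hB : MeasurableSet B) {t : ℝ} (ht : 0 ≤ t)
    (hAB : ∀ x ∈ B, ∃ c : Fin N → ℝ, (∀ i, 0 ≤ c i) ∧ ∑ i, c i ^ 2 ≤ 1 ∧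
      ∀ y ∈ A, t ≤ ∑ i, c i * mismatch x y i) (m : ℕ) :
    ((m * m - m : ℕ) ^ N : ℝ≥0∞) *
        ((Measure.pi fun _ : Fin N => μ) A * (Measure.pi fun _ : Fin N => μ) B) ≤
      ENNReal.ofReal ((m : ℝ) ^ (2 * N) * Real.exp (-t ^ 2 / 4)) := by
  classical
  set Q : Measure (Fin N × Fin m → Ω) := Measure.pi fun _ => μ
  let S (ω : Fin N × Fin m → Ω) (C : Set (Fin N → Ω)) : Finset (Fin N → Fin m) :=
    Finset.univ.filter fun j => (fun i => ω (i, j i)) ∈ C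
  let E (p : (Fin N → Fin m) × (Fin N → Fin m)) : Set (Fin N × Fin m → Ω) :=
    {ω | (fun i => ω (i, p.1 i)) ∈ A ∧ (fun i => ω (i, p.2 i)) ∈ B}
  have hE (p) : MeasurableSet (E p) :=
    (hA.preimage (f := fun (ω : Fin N × Fin m → Ω) i => ω (i, p.1 i)) (by fun_prop)).inter
      (hB.preimage (f := fun (ω : Fin N × Fin m → Ω) i => ω (i, p.2 i)) (by fun_prop))
  have hQ (p : (Fin N → Fin m) × (Fin N → Fin m)) (hp : ∀ i, p.1 i ≠ p.2 i) : Q (E p) =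
      (Measure.pi fun _ : Fin N => μ) A * (Measure.pi fun _ : Fin N => μ) B := by
    refine pi_inter_comp_eq_mul μ (fun i j h => (Prod.ext_iff.1 h).1)
      (fun i j h => (Prod.ext_iff.1 h).1) (fun i j h => ?_) hA hB
    obtain ⟨rfl, h⟩ := Prod.ext_iff.1 h
    exact hp _ h
  have hS (ω : Fin N × Fin m → Ω) :
      ((S ω A).card : ℝ) * (S ω B).card ≤ (m : ℝ) ^ (2 * N) * Real.exp (-t ^ 2 / 4) := by
    have h := card_mul_card_le_of_convexDist (A := S ω A) (B := S ω B) ht fun j hj => ?_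
    · simpa using h
    obtain ⟨c, hc0, hc1, hc⟩ := hAB _ (Finset.mem_filter.1 hj).2
    refine ⟨c, hc1, fun k hk => (hc _ (Finset.mem_filter.1 hk).2).trans ?_⟩
    gcongr with i
    · exact hc0 i
    · exact discreteDist_map_le (fun l => ω (i, l)) (j i) (k i)
  calc _ = ∑ p : (Fin N → Fin m) × (Fin N → Fin m) with ∀ i, p.1 i ≠ p.2 i, Q (E p) := by
        rw [Finset.sum_congr rfl fun p hp => hQ p (Finset.mem_filter.1 hp).2,
          Finset.sum_const, card_pairwise_ne, nsmul_eq_mul]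
        norm_cast
    _ ≤ ∑ p, Q (E p) := Finset.sum_le_univ_sum_of_nonneg fun _ => zero_le
    _ = ∫⁻ ω, ∑ p, (E p).indicator 1 ω ∂Q := by
        rw [lintegral_finsetSum _ fun p _ => measurable_one.indicator (hE p)]
        simp only [lintegral_indicator_one (hE _)]
    _ ≤ ∫⁻ _, ENNReal.ofReal ((m : ℝ) ^ (2 * N) * Real.exp (-t ^ 2 / 4)) ∂Q := by
        refine lintegral_mono fun ω => ?_
        have hsum : ∑ p, (E p).indicator (1 : (Fin N × Fin m → Ω) → ℝ≥0∞) ω =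
            ((S ω A ×ˢ S ω B).card : ℝ≥0∞) := by
          have hmem (p) : p ∈ S ω A ×ˢ S ω B ↔ ω ∈ E p := by simp [S, E]
          rw [Finset.cast_card, ← Finset.sum_subset (Finset.subset_univ (S ω A ×ˢ S ω B))]
          · exact Finset.sum_congr rfl fun p hp => Set.indicator_of_mem ((hmem p).1 hp) _
          · exact fun p _ hp => Set.indicator_of_notMem (mt (hmem p).2 hp) _
        rw [hsum, Finset.card_product, ← ENNReal.ofReal_natCast, Nat.cast_mul]
        exact ENNReal.ofReal_le_ofReal (hS ω)
    _ = _ := by simp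

/-- **Talagrand's convex distance inequality** for a pair of measurable sets. -/
theorem measureReal_mul_measureReal_le_of_convexDist {Ω : Type*} [MeasurableSpace Ω]
    (μ : Measure Ω) [IsProbabilityMeasure μ] {N : ℕ} {A B : Set (Fin N → Ω)}
    (hA : MeasurableSet A) (hB : MeasurableSet B) {t : ℝ} (ht : 0 ≤ t)
    (hAB : ∀ x ∈ B, ∃ c : Fin N → ℝ, (∀ i, 0 ≤ c i) ∧ ∑ i, c i ^ 2 ≤ 1 ∧
      ∀ y ∈ A, t ≤ ∑ i, c i * mismatch x y i) :
    (Measure.pi fun _ : Fin N => μ).real A * (Measure.pi fun _ : Fin N => μ).real B ≤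
      Real.exp (-t ^ 2 / 4) := by
  set P := Measure.pi fun _ : Fin N => μ
  have hn (n : ℕ) : ((n : ℝ) / (n + 1)) ^ N * (P.real A * P.real B) ≤
      Real.exp (-t ^ 2 / 4) := by
    have h := ENNReal.toReal_mono ENNReal.ofReal_ne_top
      (pow_mul_measure_mul_measure_le μ hA hB ht hAB (n + 1))
    rw [ENNReal.toReal_ofReal (by positivity), ENNReal.toReal_mul, ENNReal.toReal_mul,
      ENNReal.toReal_pow, ENNReal.toReal_natCast,
      show (n + 1) * (n + 1) - (n + 1) = n * (n + 1) by rw [← Nat.sub_one_mul]; rfl] at h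
    change _ * (P.real A * P.real B) ≤ _ at h
    have hpos : (0 : ℝ) < ((n : ℝ) + 1) ^ (2 * N) := by positivity
    refine le_of_mul_le_mul_left (le_of_eq_of_le ?_ h) (by exact_mod_cast hpos)
    push_cast
    rw [div_pow, pow_mul, mul_pow, sq, mul_pow]
    field_simp
  have hlim : Filter.Tendsto (fun n : ℕ => ((n : ℝ) / (n + 1)) ^ N * (P.real A * P.real B))
      Filter.atTop (nhds (1 ^ N * (P.real A * P.real B))) :=
    ((tendsto_natCast_div_add_atTop (1 : ℝ)).pow N).mul_const _
  simpa using le_of_tendsto' hlim hn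

theorem div_sqrt_le_div_sqrt {a b n : ℝ} (ha : 0 ≤ a) (hb : 0 < b) (hn : b ≤ n) :
    (b - a) / √b ≤ (n - a) / √n := by
  have hn0 : 0 < n := hb.trans_le hn
  have h : a / √n ≤ a / √b := by gcongr
  rw [sub_div, sub_div, Real.div_sqrt, Real.div_sqrt]
  linarith [Real.sqrt_le_sqrt hn]

/-- Deviation inequality between two levels `a < b` of a configuration function. -/
theorem measureReal_le_mul_measureReal_ge_le {Ω : Type*} [MeasurableSpace Ω] (μ : Measure Ω)
    [IsProbabilityMeasure μ] {N : ℕ} {L : (Fin N → Ω) → ℕ} (hL : Measurable L)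
    (hconf : ∀ x : Fin N → Ω, ∃ J : Finset (Fin N), J.card = L x ∧
      ∀ y : Fin N → Ω, Nat.card {i : Fin N // i ∈ J ∧ y i = x i} ≤ L y)
    {a b : ℝ} (ha : 0 ≤ a) (hab : a < b) :
    (Measure.pi fun _ : Fin N => μ).real {x | (L x : ℝ) ≤ a} *
        (Measure.pi fun _ : Fin N => μ).real {x | b ≤ (L x : ℝ)} ≤
      Real.exp (-(b - a) ^ 2 / (4 * b)) := by
  classical
  have hb : 0 < b := ha.trans_lt hab
  have hL' : Measurable fun x => (L x : ℝ) := measurable_from_nat.comp hL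
  have h := measureReal_mul_measureReal_le_of_convexDist μ
    (measurableSet_le hL' measurable_const) (measurableSet_le measurable_const hL')
    (t := (b - a) / √b) (div_nonneg (by linarith) (Real.sqrt_nonneg b))
    (A := {x | (L x : ℝ) ≤ a}) (B := {x | b ≤ (L x : ℝ)}) fun x hx => ?_
  · rwa [div_pow, Real.sq_sqrt hb.le, ← neg_div, div_div, mul_comm b] at h
  obtain ⟨J, hJ, hJy⟩ := hconf x
  have hn : (0 : ℝ) < L x := hb.trans_le hx
  refine ⟨fun i => if i ∈ J then (√(L x))⁻¹ else 0, fun i => by positivity, ?_, fun y hy => ?_⟩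
  · simp [ite_pow, Finset.sum_ite_mem, hJ, Real.sq_sqrt hn.le, hn.ne']
  · have hcard : (J.card : ℝ) = (J.filter fun i => y i = x i).card +
        ∑ i ∈ J, mismatch x y i := by
      rw [Finset.card_eq_sum_ones, Finset.card_filter]
      push_cast
      rw [← Finset.sum_add_distrib]
      refine Finset.sum_congr rfl fun i _ => ?_
      by_cases hi : y i = x i
      · simp [mismatch, discreteDist, hi]
      · simp [mismatch, discreteDist, hi, Ne.symm hi]
    have hJa : ((J.filter fun i => y i = x i).card : ℝ) ≤ a := by
      refine le_trans ?_ hy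
      have := hJy y
      rw [Nat.card_eq_fintype_card, Fintype.card_subtype] at this
      exact_mod_cast le_of_eq_of_le (congrArg _ (by ext; simp)) this
    calc (b - a) / √b ≤ (L x - a) / √(L x) := div_sqrt_le_div_sqrt ha hb hx
      _ ≤ (∑ i ∈ J, mismatch x y i) / √(L x) := by
          rw [hJ] at hcard
          gcongr
          linarith
      _ = _ := by
          simp [ite_mul, Finset.sum_ite_mem, ← Finset.mul_sum, div_eq_inv_mul]

/-- Theorem 7.1.3 of Talagrand: if `L` is a measurable configuration function on `Ω^N`
(for every `x` there is `J ⊆ {1,…,N}` with `card J = L(x)` such that every `y`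
satisfies `L(y) ≥ card {i ∈ J : y_i = x_i}`), and `M > 0` is a median of `L` under
`P = μ^{⊗N}`, then for all `u > 0`, `P(L ≥ M + u) ≤ 2 exp(-u²/(4(M+u)))` and
`P(L ≤ M - u) ≤ 2 exp(-u²/(4M))`. -/
theorem talagrand_stmt19 {Ω : Type*} [MeasurableSpace Ω] (μ : Measure Ω)
    [IsProbabilityMeasure μ] (N : ℕ) (hN : 1 ≤ N)
    (L : (Fin N → Ω) → ℕ) (hL : Measurable L)
    (hconf : ∀ x : Fin N → Ω, ∃ J : Finset (Fin N), J.card = L x ∧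
      ∀ y : Fin N → Ω, Nat.card {i : Fin N // i ∈ J ∧ y i = x i} ≤ L y)
    (M : ℝ) (hM : 0 < M)
    (hmed₁ : 2⁻¹ ≤ piP μ N {x | M ≤ (L x : ℝ)})
    (hmed₂ : 2⁻¹ ≤ piP μ N {x | (L x : ℝ) ≤ M}) :
    ∀ u : ℝ, 0 < u →
      piP μ N {x | M + u ≤ (L x : ℝ)} ≤
          ENNReal.ofReal (2 * Real.exp (-u ^ 2 / (4 * (M + u)))) ∧
        piP μ N {x | (L x : ℝ) ≤ M - u} ≤
          ENNReal.ofReal (2 * Real.exp (-u ^ 2 / (4 * M))) := by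
  intro u hu
  have hhalf {S : Set (Fin N → Ω)} (hS : 2⁻¹ ≤ piP μ N S) :
      2⁻¹ ≤ (Measure.pi fun _ : Fin N => μ).real S := by
    simpa [measureReal_def] using ENNReal.toReal_mono (measure_ne_top (Measure.pi fun _ : Fin N => μ) S) hS
  have hbound {S : Set (Fin N → Ω)} {r : ℝ}
      (hS : (Measure.pi fun _ : Fin N => μ).real S ≤ r) : piP μ N S ≤ ENNReal.ofReal r :=
    (ENNReal.le_ofReal_iff_toReal_le (measure_ne_top (Measure.pi fun _ : Fin N => μ) S)
      (measureReal_nonneg.trans hS)).2 hS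
  refine ⟨hbound ?_, ?_⟩
  · have h := measureReal_le_mul_measureReal_ge_le μ hL hconf hM.le (lt_add_of_pos_right M hu)
    rw [add_sub_cancel_left] at h
    have := mul_le_mul_of_nonneg_right (hhalf hmed₂)
      (measureReal_nonneg (μ := Measure.pi fun _ : Fin N => μ)
        (s := {x | M + u ≤ (L x : ℝ)}))
    linarith
  · rcases lt_or_ge M u with hMu | hMu
    · have hempty : {x | (L x : ℝ) ≤ M - u} = ∅ := by
        ext x
        simpa using (sub_neg.2 hMu).trans_le (Nat.cast_nonneg (L x))
      simp [hempty]
    · refine hbound ?_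
      have h := measureReal_le_mul_measureReal_ge_le μ hL hconf (sub_nonneg.2 hMu)
        (sub_lt_self M hu)
      rw [sub_sub_self] at h
      have := mul_le_mul_of_nonneg_left (hhalf hmed₁)
        (measureReal_nonneg (μ := Measure.pi fun _ : Fin N => μ)
          (s := {x | (L x : ℝ) ≤ M - u}))
      linarith
end
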